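/- Let F be a differential field of characteristic zero with field of constants C, let f₁, …, fₙ ∈ F satisfy condition (C), and let F ⊆ E be an extension of differential fields with E = F(x_{i,j} : 1 ≤ i ≤ n, 1 ≤ j ≤ n+1−i), where the x_{i,j} are algebraically independent over F and x_{1,j}′ = f_j, x_{i,j}′ = f_j · x_{i−1, j+1} for 2 ≤ i ≤ n. Let R = F[x_{i,j}] be the F-subalgebra of E generated by all x_{i,j}, and let S be any nonzero differential ring (a commutative ring with a derivation in which 1 ≠ 0) that is an F-algebra whose derivation restricts to the derivation of F. Then every F-algebra homomorphism φ : R → S commuting with the derivations is injective. In particular, the images φ(x_{i,j}) are algebraically independent over F. -/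

import Mathlib

namespace IteratedIntegral

open MvPolynomial

/-- The index set of the staircase of variables `x_{i,j}`, `i, j ≥ 1`, `i + j ≤ n + 1`. -/
abbrev Idx (n : ℕ) : Type := {p : ℕ × ℕ // 1 ≤ p.1 ∧ 1 ≤ p.2 ∧ p.1 + p.2 ≤ n + 1}

/-- The weight of the variable `x_{i,j}` is `i`. -/
abbrev wt (n : ℕ) (p : Idx n) : ℕ := p.1.1

variable {K : Type*} [Field K] {n : ℕ}

variable (K n) in
/-- The variable `x_{i,j}`, extended by `x_{0,j} = 1` and by zero off the staircase. -/
noncomputable def var (i j : ℕ) : MvPolynomial (Idx n) K :=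
  if h : 1 ≤ i ∧ 1 ≤ j ∧ i + j ≤ n + 1 then X ⟨(i, j), h⟩ else if i = 0 then 1 else 0

variable (K n) in
/-- The `K`-derivation with `x_{i,j} ↦ x_{i-k,j+k}` for `i ≥ k`, all other variables being
sent to zero. -/
noncomputable def shift (k j : ℕ) : Derivation K (MvPolynomial (Idx n) K)
    (MvPolynomial (Idx n) K) :=
  mkDerivation K fun p => if p.1.2 = j ∧ k ≤ p.1.1 then var K n (p.1.1 - k) (j + k) else 0

theorem var_zero (j : ℕ) : var K n 0 j = 1 := by
  simp [var]

theorem shift_X (k j : ℕ) (p : Idx n) :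
    shift K n k j (X p) =
      if p.1.2 = j ∧ k ≤ p.1.1 then var K n (p.1.1 - k) (j + k) else 0 :=
  mkDerivation_X _ _ _

theorem shift_var {k : ℕ} (hk : 1 ≤ k) (j i l : ℕ) (h : i + l ≤ n + 1) (hl : 1 ≤ l) :
    shift K n k j (var K n i l) =
      if l = j ∧ k ≤ i then var K n (i - k) (j + k) else 0 := by
  rcases Nat.eq_zero_or_pos i with rfl | hi
  · rw [var_zero, Derivation.map_one_eq_zero, if_neg (by omega)]
  · rw [var, dif_pos ⟨hi, hl, h⟩, shift_X]

theorem shift_succ {k : ℕ} (hk : 1 ≤ k) (j : ℕ) :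
    shift K n (k + 1) j = ⁅shift K n k (j + 1), shift K n 1 j⁆ := by
  refine derivation_ext fun p => ?_
  obtain ⟨⟨i, l⟩, hi, hl, hil⟩ := p
  dsimp only at hi hl hil
  rw [Derivation.commutator_apply, shift_X, shift_X, shift_X]
  dsimp only
  have h₁ : shift K n k (j + 1) (if l = j ∧ 1 ≤ i then var K n (i - 1) (j + 1) else 0) =
      if l = j ∧ k + 1 ≤ i then var K n (i - (k + 1)) (j + (k + 1)) else 0 := by
    by_cases hlj : l = j
    · subst hlj
      rw [if_pos ⟨rfl, hi⟩, shift_var hk _ _ _ (by omega) (by omega)]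
      by_cases hki : k + 1 ≤ i
      · rw [if_pos ⟨rfl, by omega⟩, if_pos ⟨rfl, hki⟩]
        congr 1 <;> omega
      · rw [if_neg (by omega), if_neg (by omega)]
    · rw [if_neg (by tauto), if_neg (by tauto), map_zero]
  have h₂ : shift K n 1 j (if l = j + 1 ∧ k ≤ i then var K n (i - k) (j + 1 + k) else 0) = 0 := by
    split_ifs with h
    · rw [shift_var le_rfl _ _ _ (by omega) (by omega), if_neg (by omega)]
    · exact map_zero _
  rw [h₁, h₂, sub_zero]

theorem shift_eq_zero {q : MvPolynomial (Idx n) K}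
    (hq : ∀ j, 1 ≤ j → j ≤ n → shift K n 1 j q = 0) {k : ℕ} (hk : 1 ≤ k) :
    ∀ j, 1 ≤ j → j + k ≤ n + 1 → shift K n k j q = 0 := by
  induction k, hk using Nat.le_induction with
  | base => exact fun j h₁ h₂ => hq j h₁ (by omega)
  | succ k hk ih =>
    intro j h₁ h₂
    rw [shift_succ hk, Derivation.commutator_apply, hq j h₁ (by omega),
      ih (j + 1) (by omega) (by omega), map_zero, map_zero, sub_zero]

theorem notMem_vars_of_pderiv_eq_zero {σ : Type*} [CharZero K] {q : MvPolynomial σ K} {p : σ}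
    (h : pderiv p q = 0) : p ∉ q.vars := by
  rw [mem_vars_iff_mem_support]
  rintro ⟨d, hd, hp⟩
  have hd' : d p ≠ 0 := Finsupp.mem_support_iff.1 hp
  have hc := coeff_pderiv (i := p) q (d - Finsupp.single p 1)
  rw [h, coeff_zero, Finsupp.sub_add_single_one_cancel hd'] at hc
  rcases mul_eq_zero.1 hc.symm with h0 | h0
  · exact mem_support_iff.1 hd h0
  · exact Nat.cast_add_one_ne_zero _ h0

/-- The common kernel of the operators `shift K n 1 j` consists of the constants. -/
theorem eq_C_of_shift_eq_zero [CharZero K] {q : MvPolynomial (Idx n) K}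
    (hq : ∀ j, 1 ≤ j → j ≤ n → shift K n 1 j q = 0) : q = C (coeff 0 q) := by
  rw [← vars_eq_empty_iff_eq_C, ← Finset.not_nonempty_iff_eq_empty]
  intro hne
  obtain ⟨p, hp, hmax⟩ := q.vars.exists_max_image (wt n) hne
  refine notMem_vars_of_pderiv_eq_zero ?_ hp
  rw [← shift_eq_zero hq p.2.1 p.1.2 p.2.2.1 (by have := p.2.2.2; omega)]
  refine derivation_eq_of_forall_mem_vars fun r hr => ?_
  rw [shift_X]
  by_cases hrp : r = p
  · subst hrp
    rw [pderiv_X_self, if_pos ⟨rfl, le_rfl⟩, Nat.sub_self, var_zero]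
  · rw [pderiv_X_of_ne hrp, if_neg]
    rintro ⟨h₁, h₂⟩
    exact hrp (Subtype.ext (Prod.ext (le_antisymm (hmax r hr) h₂) h₁))

theorem isWeightedHomogeneous_var (i j : ℕ) : IsWeightedHomogeneous (wt n) (var K n i j) i := by
  unfold var
  split_ifs with h h0
  · exact isWeightedHomogeneous_X K (wt n) ⟨(i, j), h⟩
  · exact h0 ▸ isWeightedHomogeneous_one K _
  · exact isWeightedHomogeneous_zero K _ _

theorem isWeightedHomogeneous_shift_monomial (j k : ℕ) {d : Idx n →₀ ℕ} (a : K)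
    (hd : Finsupp.weight (wt n) d = k + 1) :
    IsWeightedHomogeneous (wt n) (shift K n 1 j (monomial d a)) k := by
  rw [shift, mkDerivation_monomial, smul_eq_C_mul]
  refine IsWeightedHomogeneous.C_mul (IsWeightedHomogeneous.sum _ _ _ fun p hp => ?_) a
  have hw := Finsupp.weight_sub_single_add (w := wt n) (Finsupp.mem_support_iff.1 hp)
  have hp1 := p.2.1
  dsimp only
  rw [smul_eq_mul]
  split_ifs
  · have hk : k = Finsupp.weight (wt n) (d - Finsupp.single p 1) + (p.1.1 - 1) := by
      simp only [wt] at hw hd ⊢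
      omega
    rw [hk]
    exact (isWeightedHomogeneous_monomial _ _ _ rfl).mul (isWeightedHomogeneous_var _ _)
  · rw [mul_zero]
    exact isWeightedHomogeneous_zero K _ _

theorem eq_zero_of_weight_eq_zero {d : Idx n →₀ ℕ} (hd : Finsupp.weight (wt n) d = 0) : d = 0 := by
  ext p
  by_contra h
  have := Finsupp.le_weight_of_ne_zero' (wt n) h
  have := p.2.1
  simp only [wt] at *
  omega

/-- The operator `shift K n 1 j` lowers the weight by one. -/
theorem weightedHomogeneousComponent_shift (j k : ℕ) (p : MvPolynomial (Idx n) K) :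
    weightedHomogeneousComponent (wt n) k (shift K n 1 j p) =
      shift K n 1 j (weightedHomogeneousComponent (wt n) (k + 1) p) := by
  induction p using MvPolynomial.induction_on' with
  | add p q hp hq => simp only [map_add, hp, hq]
  | monomial d a =>
    have hm := isWeightedHomogeneous_monomial (wt n) d a rfl
    by_cases hd : Finsupp.weight (wt n) d = k + 1
    · rw [(isWeightedHomogeneous_shift_monomial j k a hd).weightedHomogeneousComponent_same,
        (isWeightedHomogeneous_monomial (wt n) d a hd).weightedHomogeneousComponent_same]
    · rw [hm.weightedHomogeneousComponent_ne _ (Ne.symm hd), map_zero]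
      rcases Nat.eq_zero_or_pos (Finsupp.weight (wt n) d) with h0 | h0
      · obtain rfl := eq_zero_of_weight_eq_zero h0
        rw [← C_apply, derivation_C, map_zero]
      · obtain ⟨l, hl⟩ := Nat.exists_eq_add_of_lt h0
        rw [zero_add] at hl
        exact (isWeightedHomogeneous_shift_monomial j l a hl).weightedHomogeneousComponent_ne _
          (by omega)

section CoefficientDerivation

variable {σ : Type*} (δ : Derivation ℤ K K)

/-- Application of a derivation to all coefficients of a polynomial. -/
noncomputable def coeffD : MvPolynomial σ K →+ MvPolynomial σ K where
  toFun p := AddMonoidAlgebra.map (δ : K →+ K) p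
  map_zero' := by ext d; simp
  map_add' p q := by ext d; simp

theorem coeff_coeffD (d : σ →₀ ℕ) (p : MvPolynomial σ K) :
    coeff d (coeffD δ p) = δ (coeff d p) :=
  rfl

theorem coeffD_C (a : K) : coeffD δ (C a : MvPolynomial σ K) = C (δ a) := by
  classical
  ext d
  rw [coeff_coeffD, coeff_C, coeff_C]
  split_ifs <;> simp

theorem coeffD_mul_X (p : MvPolynomial σ K) (i : σ) :
    coeffD δ (p * X i) = coeffD δ p * X i := by
  classical
  ext d
  rw [coeff_coeffD, coeff_mul_X', coeff_mul_X', coeff_coeffD]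
  split_ifs <;> simp

theorem coeffD_mul_var (p : MvPolynomial (Idx n) K) (i j : ℕ) :
    coeffD δ (p * var K n i j) = coeffD δ p * var K n i j := by
  unfold var
  split_ifs
  · exact coeffD_mul_X δ p _
  · rw [mul_one, mul_one]
  · rw [mul_zero, mul_zero, map_zero]

theorem coeffD_shift (k j : ℕ) (p : MvPolynomial (Idx n) K) :
    coeffD δ (shift K n k j p) = shift K n k j (coeffD δ p) := by
  induction p using MvPolynomial.induction_on with
  | C a => rw [coeffD_C, derivation_C, derivation_C, map_zero]
  | add p q hp hq => simp only [map_add, hp, hq]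
  | mul_X p i hp =>
    rw [coeffD_mul_X, Derivation.leibniz, Derivation.leibniz, map_add, smul_eq_mul, smul_eq_mul,
      smul_eq_mul, smul_eq_mul, mul_comm (X i), coeffD_mul_X, hp, mul_comm (X i), shift_X]
    split_ifs
    · rw [coeffD_mul_var]
    · rw [mul_zero, mul_zero, map_zero]

variable (n) in
/-- The derivation of `K[x_{i,j}]` extending `δ` with `x_{i,j}' = f_j x_{i-1,j+1}`,
as an additive map. -/
noncomputable def totalD (f : ℕ → K) (p : MvPolynomial (Idx n) K) : MvPolynomial (Idx n) K :=
  coeffD δ p + ∑ j ∈ Finset.Icc 1 n, C (f j) * shift K n 1 j p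

theorem coeff_totalD (f : ℕ → K) (p : MvPolynomial (Idx n) K) (d : Idx n →₀ ℕ) :
    coeff d (totalD n δ f p) =
      δ (coeff d p) + ∑ j ∈ Finset.Icc 1 n, f j * coeff d (shift K n 1 j p) := by
  simp [totalD, coeff_coeffD, coeff_sum, coeff_C_mul]

end CoefficientDerivation

theorem coeff_shift_eq_coeff_shift_component (j : ℕ) (p : MvPolynomial (Idx n) K) (d : Idx n →₀ ℕ) :
    coeff d (shift K n 1 j p) =
      coeff d (shift K n 1 j
        (weightedHomogeneousComponent (wt n) (Finsupp.weight (wt n) d + 1) p)) := by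
  rw [← weightedHomogeneousComponent_shift, coeff_weightedHomogeneousComponent, if_pos rfl]

/-- Differentiation does not raise the weight, and acts on top coefficients by `δ`. -/
theorem coeff_totalD_of_le_weight (δ : Derivation ℤ K K) (f : ℕ → K) {m : ℕ}
    {p : MvPolynomial (Idx n) K}
    (hp : ∀ d, m < Finsupp.weight (wt n) d → coeff d p = 0)
    {d : Idx n →₀ ℕ} (hd : m ≤ Finsupp.weight (wt n) d) :
    coeff d (totalD n δ f p) = δ (coeff d p) := by
  rw [coeff_totalD, Finset.sum_eq_zero, add_zero]
  intro j _
  rw [coeff_shift_eq_coeff_shift_component, weightedHomogeneousComponent_eq_zero', map_zero,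
    coeff_zero, mul_zero]
  intro e he hew
  exact mem_support_iff.1 he (hp e (by omega))

/-- A polynomial of weight at most `m` with zero derivative and nonzero component of weight `m`
is a constant, provided `f` satisfies condition (C). -/
theorem eq_C_of_totalD_eq_zero [CharZero K] (δ : Derivation ℤ K K) (f : ℕ → K)
    (hC : ∀ (c : ℕ → K) (g : K), (∀ j, 1 ≤ j → j ≤ n → δ (c j) = 0) →
      ∑ j ∈ Finset.Icc 1 n, c j * f j = δ g → ∀ j, 1 ≤ j → j ≤ n → c j = 0)
    {m : ℕ} {p : MvPolynomial (Idx n) K}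
    (hp : ∀ d, m < Finsupp.weight (wt n) d → coeff d p = 0)
    (hm : weightedHomogeneousComponent (wt n) m p ≠ 0)
    (h0 : totalD n δ f p = 0) : p = C (coeff 0 p) := by
  classical
  set q := weightedHomogeneousComponent (wt n) m p with hq
  have hqδ : coeffD δ q = 0 := by
    ext d
    rw [coeff_coeffD, hq, coeff_weightedHomogeneousComponent, coeff_zero]
    split_ifs with hd
    · rw [← coeff_totalD_of_le_weight δ f hp hd.ge, h0, coeff_zero]
    · exact map_zero δ
  have hm0 : m = 0 := by
    by_contra hm0
    obtain ⟨l, rfl⟩ := Nat.exists_eq_succ_of_ne_zero hm0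
    have hshift : ∀ j, 1 ≤ j → j ≤ n → shift K n 1 j q = 0 := by
      intro j hj hjn
      rw [hq, ← weightedHomogeneousComponent_shift]
      ext d
      rw [coeff_weightedHomogeneousComponent, coeff_zero]
      split_ifs with hd
      · refine hC (fun j => coeff d (shift K n 1 j p)) (-coeff d p) (fun i _ _ => ?_) ?_ j hj hjn
        · rw [coeff_shift_eq_coeff_shift_component, hd, ← Nat.succ_eq_add_one, ← hq,
            ← coeff_coeffD, coeffD_shift, hqδ, map_zero, coeff_zero]
        · have := coeff_totalD δ f p d
          rw [h0, coeff_zero] at this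
          rw [map_neg, eq_neg_iff_add_eq_zero, add_comm, this]
          simp only [mul_comm]
      · rfl
    have hconst := eq_C_of_shift_eq_zero hshift
    rw [hq, coeff_weightedHomogeneousComponent, map_zero, if_neg (by omega), C_0] at hconst
    exact hm hconst
  subst hm0
  ext d
  rw [coeff_C]
  split_ifs with hd
  · rw [hd]
  · exact hp d (Nat.pos_of_ne_zero fun h => hd (eq_zero_of_weight_eq_zero h).symm)

theorem one_mem_of_card_support_le [CharZero K] (δ : Derivation ℤ K K) (f : ℕ → K)
    (hC : ∀ (c : ℕ → K) (g : K), (∀ j, 1 ≤ j → j ≤ n → δ (c j) = 0) →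
      ∑ j ∈ Finset.Icc 1 n, c j * f j = δ g → ∀ j, 1 ≤ j → j ≤ n → c j = 0)
    (I : Submodule K (MvPolynomial (Idx n) K)) (hI : ∀ p ∈ I, totalD n δ f p ∈ I) (m : ℕ) :
    ∀ (N : ℕ) (p : MvPolynomial (Idx n) K), p ∈ I → p ≠ 0 →
      (∀ d, m < Finsupp.weight (wt n) d → coeff d p = 0) →
      (weightedHomogeneousComponent (wt n) m p).support.card ≤ N → 1 ∈ I := by
  classical
  induction m using Nat.strong_induction_on with
  | _ m ihm =>
  intro N
  induction N using Nat.strong_induction_on with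
  | _ N ihN =>
  intro p hpI hp0 hp hN
  by_cases hq : weightedHomogeneousComponent (wt n) m p = 0
  · have hcoeff : ∀ d, m ≤ Finsupp.weight (wt n) d → coeff d p = 0 := by
      intro d hd
      rcases hd.eq_or_lt with rfl | hd
      · simpa [coeff_weightedHomogeneousComponent] using congrArg (coeff d) hq
      · exact hp d hd
    rcases Nat.eq_zero_or_pos m with rfl | hm
    · exact absurd (MvPolynomial.ext _ _ fun d => hcoeff d (Nat.zero_le _)) hp0
    · exact ihm (m - 1) (by omega) _ p hpI hp0 (fun d hd => hcoeff d (by omega)) le_rfl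
  · obtain ⟨e, he⟩ := support_nonempty.2 hq
    have hew : Finsupp.weight (wt n) e = m ∧ coeff e p ≠ 0 := by
      simpa [coeff_weightedHomogeneousComponent] using he
    set r := (coeff e p)⁻¹ • p with hr
    have hrI : r ∈ I := I.smul_mem _ hpI
    have hrm : ∀ d, m < Finsupp.weight (wt n) d → coeff d r = 0 := fun d hd => by
      rw [hr, coeff_smul, hp d hd, smul_zero]
    have hre : coeff e r = 1 := by rw [hr, coeff_smul, smul_eq_mul, inv_mul_cancel₀ hew.2]
    by_cases h0 : totalD n δ f r = 0
    · have hrq : weightedHomogeneousComponent (wt n) m r ≠ 0 := by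
        rw [hr, map_smul]
        exact smul_ne_zero (inv_ne_zero hew.2) hq
      have hrC := eq_C_of_totalD_eq_zero δ f hC hrm hrq h0
      have he0 : e = 0 := by
        by_contra he0
        rw [hrC, coeff_C, if_neg (Ne.symm he0)] at hre
        exact zero_ne_one hre
      rw [he0] at hre
      rw [hre, C_1] at hrC
      rwa [← hrC]
    · have hlt : (weightedHomogeneousComponent (wt n) m (totalD n δ f r)).support.card < N := by
        refine lt_of_lt_of_le (Finset.card_lt_card ?_) hN
        refine Finset.ssubset_iff_of_subset (fun d hd => ?_) |>.2 ⟨e, he, ?_⟩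
        · rw [mem_support_iff, coeff_weightedHomogeneousComponent] at hd ⊢
          split_ifs at hd ⊢ with hdw
          · rw [coeff_totalD_of_le_weight δ f hrm hdw.ge] at hd
            intro hdp
            rw [hr, coeff_smul, hdp, smul_zero, map_zero] at hd
            exact hd rfl
          · exact absurd rfl hd
        · rw [notMem_support_iff, coeff_weightedHomogeneousComponent, if_pos hew.1,
            coeff_totalD_of_le_weight δ f hrm hew.1.ge, hre, Derivation.map_one_eq_zero]
      refine ihN _ hlt _ (hI r hrI) h0 (fun d hd => ?_) le_rfl
      rw [coeff_totalD_of_le_weight δ f hrm hd.le, hrm d hd, map_zero]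

/-- Under condition (C), a nonzero subspace of `K[x_{i,j}]` stable under the derivation
contains `1`; in particular `K[x_{i,j}]` is differentially simple. -/
theorem one_mem_of_totalD_stable [CharZero K] (δ : Derivation ℤ K K) (f : ℕ → K)
    (hC : ∀ (c : ℕ → K) (g : K), (∀ j, 1 ≤ j → j ≤ n → δ (c j) = 0) →
      ∑ j ∈ Finset.Icc 1 n, c j * f j = δ g → ∀ j, 1 ≤ j → j ≤ n → c j = 0)
    (I : Submodule K (MvPolynomial (Idx n) K)) (hI : ∀ p ∈ I, totalD n δ f p ∈ I)
    {p : MvPolynomial (Idx n) K} (hpI : p ∈ I) (hp0 : p ≠ 0) : 1 ∈ I := by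
  refine one_mem_of_card_support_le δ f hC I hI (weightedTotalDegree (wt n) p) _ p hpI hp0
    (fun d hd => ?_) le_rfl
  by_contra h
  exact hd.not_ge (le_weightedTotalDegree (wt n) (mem_support_iff.2 h))

/-- A derivation `D` with `D a = δ a` on coefficients and the prescribed values at the points
`y p` is computed by `totalD` under evaluation at `y`. -/
theorem derivation_aeval {A : Type*} [CommRing A] [Algebra K A] (D : Derivation ℤ A A)
    (δ : Derivation ℤ K K) (f : ℕ → K) (y : Idx n → A)
    (hδ : ∀ a, D (algebraMap K A a) = algebraMap K A (δ a))
    (hy : ∀ p : Idx n, D (y p) =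
      algebraMap K A (f p.1.2) * aeval y (var K n (p.1.1 - 1) (p.1.2 + 1)))
    (p : MvPolynomial (Idx n) K) : D (aeval y p) = aeval y (totalD n δ f p) := by
  induction p using MvPolynomial.induction_on with
  | C a =>
    simp [totalD, coeffD_C, derivation_C, hδ]
  | add p q hp hq =>
    rw [map_add, map_add, hp, hq, ← map_add]
    simp only [totalD, map_add, mul_add, Finset.sum_add_distrib]
    exact add_add_add_comm _ _ _ _
  | mul_X p i hp =>
    have hX : ∑ j ∈ Finset.Icc 1 n, C (f j) * shift K n 1 j (X i) =
        C (f i.1.2) * var K n (i.1.1 - 1) (i.1.2 + 1) := by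
      have h := i.2
      rw [Finset.sum_eq_single i.1.2]
      · rw [shift_X, if_pos ⟨rfl, h.1⟩]
      · intro j _ hj
        rw [shift_X, if_neg (by tauto), mul_zero]
      · intro hj
        exact absurd (Finset.mem_Icc.2 ⟨h.2.1, by omega⟩) hj
    have hmul : totalD n δ f (p * X i) =
        p * (C (f i.1.2) * var K n (i.1.1 - 1) (i.1.2 + 1)) + X i * totalD n δ f p := by
      rw [← hX, totalD, totalD, coeffD_mul_X, mul_add, Finset.mul_sum, Finset.mul_sum]
      simp only [Derivation.leibniz, smul_eq_mul, mul_add, Finset.sum_add_distrib,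
        mul_left_comm (C _)]
      ring
    rw [map_mul, Derivation.leibniz, hp, aeval_X, hy, hmul]
    simp only [map_add, map_mul, aeval_X, algHom_C, smul_eq_mul]

end IteratedIntegral

/-- For the extension `E = F(x_{i,j})` built from `f₁, …, fₙ`
satisfying condition (C), let `R = F[x_{i,j}]` be the `F`-subalgebra of `E` generated by
the `x_{i,j}` (closed under the derivation), and let `S` be any nonzero commutative
`F`-algebra equipped with a derivation `d` restricting to the derivation of `F`.  Then
every `F`-algebra homomorphism `φ : R → S` commuting with the derivations is injective;
in particular the images `φ(x_{i,j})` are algebraically independent over `F`. -/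
theorem diff_hom_injective
    (E : Type) [Field E] [CharZero E] (D : Derivation ℚ E E)
    (F : Subfield E) (hF : ∀ a ∈ F, D a ∈ F)
    (n : ℕ) (f : ℕ → E) (hf : ∀ j, 1 ≤ j → j ≤ n → f j ∈ F)
    (hcondC : ∀ (c : ℕ → E) (g : E),
      (∀ j, 1 ≤ j → j ≤ n → c j ∈ F ∧ D (c j) = 0) → g ∈ F →
      (∑ j ∈ Finset.Icc 1 n, c j * f j) = D g → ∀ j, 1 ≤ j → j ≤ n → c j = 0)
    (x : ℕ → ℕ → E)
    (hind : AlgebraicIndependent F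
      (fun p : {p : ℕ × ℕ // 1 ≤ p.1 ∧ 1 ≤ p.2 ∧ p.1 + p.2 ≤ n + 1} => x p.1.1 p.1.2))
    (hgen : Subfield.closure
      (↑F ∪ {a | ∃ i j, 1 ≤ i ∧ 1 ≤ j ∧ i + j ≤ n + 1 ∧ a = x i j}) = ⊤)
    (hd1 : ∀ j, 1 ≤ j → j ≤ n → D (x 1 j) = f j)
    (hdi : ∀ i j, 2 ≤ i → 1 ≤ j → i + j ≤ n + 1 → D (x i j) = f j * x (i - 1) (j + 1))
    (R : Subring E)
    (hR : R = Subring.closure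
      (↑F ∪ {a | ∃ i j, 1 ≤ i ∧ 1 ≤ j ∧ i + j ≤ n + 1 ∧ a = x i j}))
    (hRD : ∀ a ∈ R, D a ∈ R) (hFR : ∀ a ∈ F, a ∈ R)
    (hxR : ∀ i j, 1 ≤ i → 1 ≤ j → i + j ≤ n + 1 → x i j ∈ R)
    (S : Type) [CommRing S] [Nontrivial S] [Algebra F S]
    (d : S → S)
    (hd_add : ∀ a b : S, d (a + b) = d a + d b)
    (hd_mul : ∀ a b : S, d (a * b) = a * d b + b * d a)
    (hd_res : ∀ (a : E) (ha : a ∈ F),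
      d (algebraMap F S ⟨a, ha⟩) = algebraMap F S ⟨D a, hF a ha⟩)
    (φ : R →+* S)
    (hφF : ∀ (a : E) (ha : a ∈ F), φ ⟨a, hFR a ha⟩ = algebraMap F S ⟨a, ha⟩)
    (hφD : ∀ a : R, φ ⟨D ↑a, hRD ↑a a.2⟩ = d (φ a)) :
    Function.Injective φ ∧
      AlgebraicIndependent F
        (fun p : {p : ℕ × ℕ // 1 ≤ p.1 ∧ 1 ≤ p.2 ∧ p.1 + p.2 ≤ n + 1} =>
          φ ⟨x p.1.1 p.1.2, hxR p.1.1 p.1.2 p.2.1 p.2.2.1 p.2.2.2⟩) := by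
  let δ : Derivation ℤ F F := Derivation.mk'
    (AddMonoidHom.toIntLinearMap
      { toFun := fun a => ⟨D a, hF a a.2⟩
        map_zero' := Subtype.ext (map_zero D)
        map_add' := fun a b => Subtype.ext (map_add D (a : E) b) })
    (fun a b => Subtype.ext (D.leibniz (a : E) b))
  have hδ (a : F) : ((δ a : F) : E) = D a := rfl
  let f' : ℕ → F := fun j => if h : 1 ≤ j ∧ j ≤ n then ⟨f j, hf j h.1 h.2⟩ else 0
  have hf' {j : ℕ} (h₁ : 1 ≤ j) (h₂ : j ≤ n) : ((f' j : F) : E) = f j := by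
    simp only [f', dif_pos (And.intro h₁ h₂)]
  have hC : ∀ (c : ℕ → F) (g : F), (∀ j, 1 ≤ j → j ≤ n → δ (c j) = 0) →
      ∑ j ∈ Finset.Icc 1 n, c j * f' j = δ g → ∀ j, 1 ≤ j → j ≤ n → c j = 0 := by
    intro c g hc hsum j h₁ h₂
    refine Subtype.ext (hcondC (fun j => c j) g (fun j h₁ h₂ => ⟨(c j).2, ?_⟩) g.2 ?_ j h₁ h₂)
    · rw [← hδ, hc j h₁ h₂, ZeroMemClass.coe_zero]
    · rw [← hδ, ← hsum, AddSubmonoidClass.coe_finsetSum]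
      refine Finset.sum_congr rfl fun j hj => ?_
      rw [Finset.mem_Icc] at hj
      rw [MulMemClass.coe_mul, hf' hj.1 hj.2]
  let y : IteratedIntegral.Idx n → E := fun p => x p.1.1 p.1.2
  have hy (p : IteratedIntegral.Idx n) : D (y p) = algebraMap F E (f' p.1.2) *
      MvPolynomial.aeval y (IteratedIntegral.var F n (p.1.1 - 1) (p.1.2 + 1)) := by
    obtain ⟨⟨i, j⟩, hi, hj, hij⟩ := p
    dsimp only at hi hj hij
    change D (x i j) = (f' j : E) * _
    rw [hf' hj (by omega)]
    dsimp only
    rcases hi.eq_or_lt with rfl | hi2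
    · rw [hd1 j hj (by omega), Nat.sub_self, IteratedIntegral.var_zero, map_one, mul_one]
    · rw [hdi i j hi2 hj hij, IteratedIntegral.var, dif_pos ⟨by omega, by omega, by omega⟩,
        MvPolynomial.aeval_X]
  have hDy (p : MvPolynomial (IteratedIntegral.Idx n) F) :
      D (MvPolynomial.aeval y p) =
        MvPolynomial.aeval y (IteratedIntegral.totalD n δ f' p) :=
    IteratedIntegral.derivation_aeval (D.restrictScalars ℤ) δ f' y (fun _ => rfl) hy p
  -- Evaluation at the `x_{i,j}` as an `F`-algebra map onto `R`.
  let _ : Algebra F R := (Subring.inclusion (S := F.toSubring) (T := R) hFR).toAlgebra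
  let z : IteratedIntegral.Idx n → R := fun p => ⟨y p, hxR _ _ p.2.1 p.2.2.1 p.2.2.2⟩
  let Φ : R →ₐ[F] S := { φ with commutes' := fun a => hφF a a.2 }
  let ι : R →ₐ[F] E := { R.subtype with commutes' := fun _ => rfl }
  have hιz (p : MvPolynomial (IteratedIntegral.Idx n) F) :
      ((MvPolynomial.aeval z p : R) : E) = MvPolynomial.aeval y p :=
    MvPolynomial.map_aeval z (ι : R →+* E) p |>.trans (by rfl)
  have hsurj : Function.Surjective (MvPolynomial.aeval z : _ →ₐ[F] R) := by
    rintro ⟨a, ha⟩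
    suffices h : a ∈ ((MvPolynomial.aeval y).range : Subalgebra F E) by
      obtain ⟨p, hp⟩ := h
      exact ⟨p, Subtype.ext ((hιz p).trans hp)⟩
    rw [hR] at ha
    refine (Subring.closure_le (t := (MvPolynomial.aeval y).range.toSubring)).2 ?_ ha
    rintro b (hb | ⟨i, j, hi, hj, hij, rfl⟩)
    · exact ⟨MvPolynomial.C ⟨b, hb⟩, MvPolynomial.aeval_C _ _⟩
    · exact ⟨MvPolynomial.X ⟨(i, j), hi, hj, hij⟩, MvPolynomial.aeval_X _ _⟩
  have hd0 : d 0 = 0 := by simpa using hd_add 0 0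
  let I : Submodule F (MvPolynomial (IteratedIntegral.Idx n) F) :=
    LinearMap.ker (Φ.comp (MvPolynomial.aeval z)).toLinearMap
  have hmemI (p) : p ∈ I ↔ φ (MvPolynomial.aeval z p) = 0 := Iff.rfl
  have hI : ∀ p ∈ I, IteratedIntegral.totalD n δ f' p ∈ I := by
    intro p hp
    rw [hmemI] at hp ⊢
    rw [← hd0, ← hp, ← hφD]
    congr 1
    exact Subtype.ext (((hιz _).trans (hDy p).symm).trans (congrArg D (hιz p).symm))
  have hI0 : ∀ p : MvPolynomial (IteratedIntegral.Idx n) F,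
      φ (MvPolynomial.aeval z p) = 0 → p = 0 := by
    intro p hp
    by_contra hp0
    have h1 := IteratedIntegral.one_mem_of_totalD_stable δ f' hC I hI ((hmemI p).2 hp) hp0
    rw [hmemI, map_one, map_one] at h1
    exact one_ne_zero h1
  constructor
  · rw [injective_iff_map_eq_zero]
    intro a ha
    obtain ⟨p, rfl⟩ := hsurj a
    rw [hI0 p ha, map_zero]
  · rw [algebraicIndependent_iff]
    intro p hp
    refine hI0 p ?_
    rw [← hp]
    exact DFunLike.congr_fun (MvPolynomial.comp_aeval z Φ) p
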